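/- arXiv:1801.08664 — 2 statements merged into one kernel-verified Lean document; each statement's English description precedes it below -/
import Mathlib

section
/- Let s′ = I(u′, L^{(N+1)/2} v) be the interleaved sequence of period 2N built from the sequences with characteristic sets (D_1 ∪ D_2, D_2 ∪ D_3). Then for 0 ≤ τ < 2N: R_{s′}(0) = 2N; R_{s′}(τ) = −2 for every even τ ≠ 0; R_{s′}(N) = −2; and for every odd τ ≠ N, R_{s′}(τ) = 2 if ((τ+N)/2 mod N) ∈ D_0 ∪ D_2 and R_{s′}(τ) = −2 if ((τ+N)/2 mod N) ∈ D_1 ∪ D_3. -/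
open Finset Polynomial

def corr (n : ℕ) (a b : ℤ → ℕ) (τ : ℤ) : ℤ :=
  ∑ i ∈ Finset.range n, (-1 : ℤ) ^ (a i + b ((i : ℤ) + τ))

def Dclass (N f : ℕ) (β : ZMod N) (j : ℕ) : Set (ZMod N) :=
  {x | ∃ k < f, x = β ^ (4 * k + j)}

open Classical in
/-- The binary sequence of period `N` whose characteristic set is `S ⊆ Z_N`. -/
noncomputable def chiSeq (N : ℕ) (S : Set (ZMod N)) : ℤ → ℕ :=
  fun t => if (t : ZMod N) ∈ S then 1 else 0

/-- The interleaved sequence `I(a,b)`: `I(a,b)(2i) = a(i)`, `I(a,b)(2i+1) = b(i)`. -/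
noncomputable def interleave (a b : ℤ → ℕ) : ℤ → ℕ :=
  fun k => if Even k then a (k / 2) else b ((k - 1) / 2)

/-- The left shift `L^m`. -/
def shiftL (m : ℤ) (a : ℤ → ℕ) : ℤ → ℕ := fun i => a (i + m)

lemma GaussianInt.re_sum {ι : Type*} (s : Finset ι) (g : ι → GaussianInt) :
    (∑ i ∈ s, g i).re = ∑ i ∈ s, (g i).re := by
  classical
  induction s using Finset.induction_on with
  | empty => simp
  | insert a s ha ih => simp [Finset.sum_insert ha, ih]

lemma GaussianInt.I_pow_four : (⟨0, 1⟩ : GaussianInt) ^ 4 = 1 := by decide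

lemma GaussianInt.I_pow_mod (n : ℕ) :
    (⟨0, 1⟩ : GaussianInt) ^ n = (⟨0, 1⟩ : GaussianInt) ^ (n % 4) := by
  conv_lhs => rw [← Nat.div_add_mod n 4, pow_add, pow_mul, I_pow_four, one_pow, one_mul]

lemma GaussianInt.I_pow_inj {m n : ℕ} (hm : m < 4) (hn : n < 4)
    (h : (⟨0, 1⟩ : GaussianInt) ^ m = (⟨0, 1⟩ : GaussianInt) ^ n) : m = n := by
  interval_cases m <;> interval_cases n <;> first | rfl | (revert h; decide)

/-- A prime is in at most one way of the form `a ^ 2 + b ^ 2`, here compared with `1 + c ^ 2`. -/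
lemma Int.sq_eq_one_of_prime_eq_one_add_sq {p a b c : ℤ} (hp : Prime p) (h1 : a ^ 2 + b ^ 2 = p)
    (h2 : 1 + c ^ 2 = p) (ha : Odd a) (hc : Even c) : a ^ 2 = 1 := by
  have hp0 : 0 < p := by nlinarith [sq_nonneg c]
  have key : ∀ b : ℤ, a ^ 2 + b ^ 2 = p → p ∣ a * c - b → a ^ 2 = 1 := by
    rintro b h1 ⟨k, hk⟩
    have hid : (a * c - b) ^ 2 + (a + b * c) ^ 2 = p ^ 2 := by
      linear_combination (1 + c ^ 2) * h1 + p * h2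
    have hkk : k ^ 2 ≤ 1 := by
      rw [hk] at hid
      by_contra! hlt
      nlinarith [sq_nonneg (a + b * c), mul_pos hp0 hp0]
    have hk0 : k = 0 ∨ k ^ 2 = 1 := by
      have : -1 ≤ k := by nlinarith
      have : k ≤ 1 := by nlinarith
      interval_cases k <;> simp
    rcases hk0 with rfl | hk1
    · have hb : b = a * c := by linarith
      have : a ^ 2 * p = p := by
        rw [hb] at h1
        linear_combination h1 - a ^ 2 * h2
      exact mul_right_cancel₀ hp0.ne' (by linarith)
    · have h0 : (a + b * c) ^ 2 = 0 := by
        rw [hk] at hid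
        linear_combination hid - p ^ 2 * hk1
      have hab : a = b * -c := by linarith [pow_eq_zero_iff (two_ne_zero) |>.mp h0]
      exfalso
      rw [hab, Int.odd_mul] at ha
      exact (Int.not_even_iff_odd.mpr ha.2) hc.neg
  have hdvd : p ∣ (a * c - b) * (a * c + b) :=
    ⟨a ^ 2 - 1, by linear_combination a ^ 2 * h2 - h1⟩
  rcases hp.dvd_or_dvd hdvd with h | h
  · exact key b h1 h
  · exact key (-b) (by simpa using h1) (by simpa using h)

lemma Fintype.sum_range_zmod {M : Type*} [AddCommMonoid M] (n : ℕ) [NeZero n] (F : ZMod n → M) :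
    ∑ i ∈ Finset.range n, F (i : ZMod n) = ∑ x, F x := by
  refine Finset.sum_bij' (fun i _ => (i : ZMod n)) (fun x _ => x.val) ?_ ?_ ?_ ?_ ?_
  · simp
  · intro x _
    simpa using ZMod.val_lt x
  · intro i hi
    exact ZMod.val_cast_of_lt (Finset.mem_range.mp hi)
  · simp
  · simp

lemma Finset.sum_range_two_mul_eq {M : Type*} [AddCommMonoid M] (n : ℕ) (g : ℕ → M) :
    ∑ i ∈ Finset.range (2 * n), g i = ∑ i ∈ Finset.range n, (g (2 * i) + g (2 * i + 1)) := by
  induction n with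
  | zero => simp
  | succ n ih => rw [mul_add, mul_one, Finset.sum_range_succ, Finset.sum_range_succ, ih,
      Finset.sum_range_succ, add_assoc]

section QuarticCharacter

variable {p : ℕ} [Fact p.Prime]

lemma sum_mul_shift_eq_jacobiSum {R : Type*} [CommRing R] (χ ψ : MulChar (ZMod p) R) {w : ZMod p}
    (hw : w ≠ 0) :
    ∑ x, χ x * ψ (x + w) = χ (-1) * χ w * ψ w * jacobiSum χ ψ := by
  rw [jacobiSum, Finset.mul_sum]
  symm
  refine Fintype.sum_equiv (Equiv.mulLeft₀ (-w) (neg_ne_zero.mpr hw)) _ _ fun z => ?_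
  have h1 : -w * z = -1 * w * z := by ring
  have h2 : -1 * w * z + w = w * (1 - z) := by ring
  change _ = χ (-w * z) * ψ (-w * z + w)
  rw [h1, h2, map_mul, map_mul, map_mul]
  ring

lemma exists_primitive_pow {β : ZMod p} (hβ : orderOf β = p - 1) {x : ZMod p} (hx : x ≠ 0) :
    ∃ n < p - 1, x = β ^ n := by
  have hp := (Fact.out : p.Prime).two_le
  have hβ0 : β ≠ 0 := by
    rintro rfl
    rw [orderOf_zero] at hβ
    omega
  have h := ZMod.pow_card_sub_one_eq_one hx
  have hprim : IsPrimitiveRoot β (p - 1) := hβ ▸ IsPrimitiveRoot.orderOf β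
  have : NeZero (p - 1) := ⟨by omega⟩
  obtain ⟨n, hn, rfl⟩ := hprim.eq_pow_of_pow_eq_one h
  exact ⟨n, hn, rfl⟩

lemma exists_unit_generator {β : ZMod p} (hβ : orderOf β = p - 1) :
    ∃ g : (ZMod p)ˣ, (g : ZMod p) = β ∧ ∀ x, x ∈ Subgroup.zpowers g := by
  have hp := (Fact.out : p.Prime).two_le
  have hβ0 : β ≠ 0 := by
    rintro rfl
    rw [orderOf_zero] at hβ
    omega
  refine ⟨Units.mk0 β hβ0, rfl, fun x => ?_⟩
  obtain ⟨n, -, hn⟩ := exists_primitive_pow hβ x.ne_zero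
  exact ⟨n, by ext; simpa using hn.symm⟩

lemma exists_quartic_mulChar {β : ZMod p} (hβ : orderOf β = p - 1) (h4 : 4 ∣ p - 1) :
    ∃ χ : MulChar (ZMod p) GaussianInt, χ β = ⟨0, 1⟩ := by
  obtain ⟨g, rfl, hg⟩ := exists_unit_generator hβ
  let ζ : GaussianIntˣ := ⟨⟨0, 1⟩, ⟨0, -1⟩, by decide, by decide⟩
  have hζ : ζ ∈ rootsOfUnity (Fintype.card (ZMod p)ˣ) GaussianInt := by
    rw [mem_rootsOfUnity, ZMod.card_units]
    obtain ⟨k, hk⟩ := h4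
    have h : ζ ^ 4 = 1 := by
      ext1
      exact GaussianInt.I_pow_four
    rw [hk, pow_mul, h, one_pow]
  exact ⟨MulChar.ofRootOfUnity hζ hg, MulChar.ofRootOfUnity_spec hζ hg⟩

variable {χ : MulChar (ZMod p) GaussianInt} {β : ZMod p}

lemma mulChar_primitive_pow (hχ : χ β = ⟨0, 1⟩) (n : ℕ) : χ (β ^ n) = ⟨0, 1⟩ ^ n := by
  rw [map_pow, hχ]

lemma quartic_values (hβ : orderOf β = p - 1) (hχ : χ β = ⟨0, 1⟩) {x : ZMod p} (hx : x ≠ 0) :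
    χ x = 1 ∨ χ x = ⟨0, 1⟩ ∨ χ x = -1 ∨ χ x = ⟨0, -1⟩ := by
  obtain ⟨n, -, rfl⟩ := exists_primitive_pow hβ hx
  rw [mulChar_primitive_pow hχ, GaussianInt.I_pow_mod]
  have : n % 4 < 4 := Nat.mod_lt _ (by norm_num)
  interval_cases n % 4 <;> decide

lemma mem_Dclass_iff {f j : ℕ} (hpf : p = 4 * f + 1) (hj : j < 4) (hβ : orderOf β = p - 1)
    (hχ : χ β = ⟨0, 1⟩) (x : ZMod p) : x ∈ Dclass p f β j ↔ χ x = ⟨0, 1⟩ ^ j := by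
  constructor
  · rintro ⟨k, -, rfl⟩
    rw [mulChar_primitive_pow hχ, pow_add, pow_mul, GaussianInt.I_pow_four, one_pow, one_mul]
  · intro h
    have hx : x ≠ 0 := by
      rintro rfl
      rw [MulChar.map_zero] at h
      interval_cases j <;> revert h <;> decide
    obtain ⟨n, hn, rfl⟩ := exists_primitive_pow hβ hx
    rw [mulChar_primitive_pow hχ, GaussianInt.I_pow_mod] at h
    have h' := GaussianInt.I_pow_inj (Nat.mod_lt _ (by norm_num)) hj h
    exact ⟨n / 4, by omega, by rw [← h', Nat.div_add_mod]⟩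

lemma quartic_neg_one {f : ℕ} (hpf : p = 4 * f + 1) (hf : Odd f) (hβ : orderOf β = p - 1)
    (hχ : χ β = ⟨0, 1⟩) : χ (-1) = -1 := by
  have hp := (Fact.out : p.Prime).two_le
  have h : β ^ (2 * f) = -1 := by
    have h1 : β ^ (2 * f) * β ^ (2 * f) = 1 := by
      rw [← pow_add, ← pow_orderOf_eq_one β, hβ]
      congr 1
      omega
    refine (mul_self_eq_one_iff.mp h1).resolve_left fun h2 => ?_
    have := Nat.le_of_dvd (by omega) (orderOf_dvd_of_pow_eq_one h2)
    omega
  have h2 : (⟨0, 1⟩ : GaussianInt) ^ 2 = -1 := by decide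
  rw [← h, mulChar_primitive_pow hχ, pow_mul, h2, hf.neg_one_pow]

lemma quartic_four {f : ℕ} (hpf : p = 4 * f + 1) (hf : Odd f) (hβ : orderOf β = p - 1)
    (hχ : χ β = ⟨0, 1⟩) : χ 4 = -1 := by
  have hp2 : p ≠ 2 := by omega
  have h20 : (2 : ZMod p) ≠ 0 := by
    intro h
    have h' : ((2 : ℕ) : ZMod p) = 0 := by exact_mod_cast h
    have := Nat.le_of_dvd (by norm_num) ((ZMod.natCast_eq_zero_iff 2 p).mp h')
    have := (Fact.out : p.Prime).two_le
    omega
  have hns : ¬ IsSquare (2 : ZMod p) := by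
    rw [ZMod.exists_sq_eq_two_iff hp2]
    obtain ⟨k, hk⟩ := hf
    omega
  obtain ⟨n, -, hn⟩ := exists_primitive_pow hβ h20
  have hodd : Odd n := by
    by_contra h
    obtain ⟨k, rfl⟩ := Nat.not_odd_iff_even.mp h
    exact hns ⟨β ^ k, by rw [hn, pow_add]⟩
  have h4 : (4 : ZMod p) = β ^ (2 * n) := by
    rw [mul_comm, pow_mul, ← hn]
    norm_num
  have h2 : (⟨0, 1⟩ : GaussianInt) ^ 2 = -1 := by decide
  rw [h4, mulChar_primitive_pow hχ, pow_mul, h2, hodd.neg_one_pow]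

lemma quartic_inv (hβ : orderOf β = p - 1) (hχ : χ β = ⟨0, 1⟩) :
    χ⁻¹ = χ.ringHomComp (starRingEnd GaussianInt) := by
  refine inv_eq_of_mul_eq_one_right ?_
  refine MulChar.ext fun x => ?_
  rcases quartic_values hβ hχ x.ne_zero with h | h | h | h <;>
    simp only [MulChar.mul_apply, MulChar.ringHomComp_apply, h, MulChar.one_apply_coe] <;> decide

lemma quartic_ne_one (hχ : χ β = ⟨0, 1⟩) : χ ≠ 1 := by
  rintro rfl
  by_cases h : IsUnit β
  · rw [MulChar.one_apply h] at hχ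
    revert hχ; decide
  · rw [MulChar.map_nonunit _ h] at hχ
    revert hχ; decide

lemma quartic_sq_ne_one (hχ : χ β = ⟨0, 1⟩) : χ * χ ≠ 1 := by
  intro h
  have h1 : χ β * χ β = (1 : MulChar (ZMod p) GaussianInt) β := by rw [← h, MulChar.mul_apply]
  rw [hχ] at h1
  by_cases h : IsUnit β
  · rw [MulChar.one_apply h] at h1
    revert h1; decide
  · rw [MulChar.map_nonunit _ h] at h1
    revert h1; decide

lemma jacobiSum_quartic_norm (hβ : orderOf β = p - 1) (hχ : χ β = ⟨0, 1⟩) :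
    (jacobiSum χ χ).re ^ 2 + (jacobiSum χ χ).im ^ 2 = p := by
  have hinj : Function.Injective GaussianInt.toComplex := GaussianInt.toComplex_injective
  have h1 : χ.ringHomComp GaussianInt.toComplex ≠ 1 :=
    (MulChar.ringHomComp_ne_one_iff hinj).mpr (quartic_ne_one hχ)
  have h2 : χ.ringHomComp GaussianInt.toComplex * χ.ringHomComp GaussianInt.toComplex ≠ 1 := by
    rw [← MulChar.ringHomComp_mul]
    exact (MulChar.ringHomComp_ne_one_iff hinj).mpr (quartic_sq_ne_one hχ)
  have hchar : ringChar ℂ ≠ ringChar (ZMod p) := by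
    rw [ZMod.ringChar_zmod_n, ringChar.eq_zero]
    exact (Fact.out : p.Prime).ne_zero.symm
  have h := jacobiSum_mul_jacobiSum_inv hchar h1 h1 h2
  rw [MulChar.ringHomComp_inv, jacobiSum_ringHomComp, jacobiSum_ringHomComp, quartic_inv hβ hχ,
    jacobiSum_ringHomComp, ← map_mul, ZMod.card, ← map_natCast GaussianInt.toComplex] at h
  have h3 := congrArg Zsqrtd.re (hinj h)
  simp only [starRingEnd_apply, Zsqrtd.re_mul, Zsqrtd.re_star, Zsqrtd.im_star,
    Zsqrtd.re_natCast] at h3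
  linarith

lemma even_card_mulChar_mul_one_sub_eq_one (h4 : χ 4 = -1) :
    Even #{x : ZMod p | χ (x * (1 - x)) = 1} := by
  rw [← ZMod.natCast_eq_zero_iff_even, Finset.cast_card]
  refine Finset.sum_involution (fun x _ => 1 - x) (fun _ _ => by decide) ?_ ?_ ?_
  · intro x hx _ h
    have h2 : 4 * (x * (1 - x)) = 1 := by linear_combination (2 * x - 1) * h
    have h3 := congrArg χ h2
    rw [map_mul, h4, (Finset.mem_filter.mp hx).2, map_one] at h3
    revert h3; decide
  · intro x hx
    simpa [mul_comm] using hx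
  · simp

lemma jacobiSum_quartic_re_emod {f : ℕ} (hpf : p = 4 * f + 1) (hf : Odd f)
    (hβ : orderOf β = p - 1) (hχ : χ β = ⟨0, 1⟩) : (jacobiSum χ χ).re % 4 = 3 := by
  have hneg := quartic_neg_one hpf hf hβ hχ
  have hsq : jacobiSum (χ * χ) (χ * χ) = -1 := by
    have hinv : χ * χ = (χ * χ)⁻¹ := by
      refine eq_inv_of_mul_eq_one_left ?_
      refine MulChar.ext fun x => ?_
      rcases quartic_values hβ hχ x.ne_zero with h | h | h | h <;>
        simp only [MulChar.mul_apply, h, MulChar.one_apply_coe] <;> decide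
    conv_lhs => arg 2; rw [hinv]
    rw [jacobiSum_nontrivial_inv (quartic_sq_ne_one hχ), MulChar.mul_apply, hneg]
    decide
  have hone : jacobiSum (1 : MulChar (ZMod p) GaussianInt) 1 = p - 2 := by
    rw [jacobiSum_one_one, ZMod.card]
  have hpt : ∀ x : ZMod p, 2 * (χ x * χ (1 - x)).re +
      (((χ * χ) x * (χ * χ) (1 - x)).re +
        ((1 : MulChar (ZMod p) GaussianInt) x * (1 : MulChar (ZMod p) GaussianInt) (1 - x)).re) =
      4 * if χ (x * (1 - x)) = 1 then 1 else 0 := by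
    intro x
    have e : (χ * χ) x * (χ * χ) (1 - x) = χ (x * (1 - x)) * χ (x * (1 - x)) := by
      rw [← map_mul, MulChar.mul_apply]
    rw [e, ← map_mul χ x, ← map_mul (1 : MulChar (ZMod p) GaussianInt)]
    by_cases hx : x * (1 - x) = 0
    · simp only [hx, MulChar.map_zero]
      decide
    · rw [MulChar.one_apply (isUnit_iff_ne_zero.mpr hx)]
      rcases quartic_values hβ hχ hx with h | h | h | h <;> rw [h] <;> decide
  have hsum := Finset.sum_congr rfl fun x (_ : x ∈ (Finset.univ : Finset (ZMod p))) => hpt x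
  rw [Finset.sum_add_distrib, Finset.sum_add_distrib, ← Finset.mul_sum, ← Finset.mul_sum,
    ← GaussianInt.re_sum, ← GaussianInt.re_sum, ← GaussianInt.re_sum] at hsum
  change 2 * (jacobiSum χ χ).re + ((jacobiSum (χ * χ) (χ * χ)).re +
    (jacobiSum (1 : MulChar (ZMod p) GaussianInt) 1).re) = _ at hsum
  rw [hsq, hone, Finset.sum_boole] at hsum
  obtain ⟨m, hm⟩ := even_card_mulChar_mul_one_sub_eq_one (quartic_four hpf hf hβ hχ)
  rw [hm] at hsum
  obtain ⟨k, rfl⟩ := hf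
  simp only [hpf, Zsqrtd.re_neg, Zsqrtd.re_one, Zsqrtd.re_sub, Zsqrtd.re_natCast,
    Zsqrtd.re_ofNat] at hsum
  push_cast at hsum
  omega

lemma jacobiSum_quartic_re {f y : ℕ} (hpf : p = 4 * f + 1) (hf : Odd f) (hfy : f = y ^ 2)
    (hβ : orderOf β = p - 1) (hχ : χ β = ⟨0, 1⟩) : (jacobiSum χ χ).re = -1 := by
  have hmod := jacobiSum_quartic_re_emod hpf hf hβ hχ
  have h := Int.sq_eq_one_of_prime_eq_one_add_sq (p := (p : ℤ)) (c := 2 * y)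
    (Nat.prime_iff_prime_int.mp Fact.out) (jacobiSum_quartic_norm hβ hχ)
    (by rw [hpf, hfy]; push_cast; ring) (Int.odd_iff.mpr (by omega)) (even_two_mul _)
  rcases (mul_self_eq_one_iff.mp (by rwa [← sq]) : (jacobiSum χ χ).re = 1 ∨ _) with h | h <;> omega

end QuarticCharacter

section InterleavedSequence

variable {p : ℕ} [Fact p.Prime]

/-- The `±1`-valued function of the sequence with characteristic set `{0} ∪ D₁ ∪ D₂`. -/
def signU (χ : MulChar (ZMod p) GaussianInt) (x : ZMod p) : ℤ :=
  (χ x).re - (χ x).im - if x = 0 then 1 else 0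

/-- The `±1`-valued function of the sequence with characteristic set `D₂ ∪ D₃`. -/
def signV (χ : MulChar (ZMod p) GaussianInt) (x : ZMod p) : ℤ :=
  (χ x).re + (χ x).im + if x = 0 then 1 else 0

variable {χ : MulChar (ZMod p) GaussianInt} {β : ZMod p}

lemma sum_im_boundary_eq_zero (hneg : χ (-1) = -1) (w : ZMod p) :
    ∑ x, ((χ x).im * (if x + w = 0 then 1 else 0) + (if x = 0 then 1 else 0) * (χ (x + w)).im) =
      0 := by
  have h : χ (-w) = -χ w := by
    rw [← neg_one_mul w, map_mul, hneg, neg_one_mul]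
  simp [Finset.sum_add_distrib, ← eq_neg_iff_add_eq_zero, h]

lemma boundary_mul_eq_zero {w : ZMod p} (hw : w ≠ 0) (x : ZMod p) :
    (if x = 0 then 1 else 0 : ℤ) * (if x + w = 0 then 1 else 0) = 0 := by
  by_cases hx : x = 0 <;> simp [hx, hw]

lemma sum_signU_mul_add_signV_mul (hβ : orderOf β = p - 1) (hχ : χ β = ⟨0, 1⟩)
    (hneg : χ (-1) = -1) {w : ZMod p} (hw : w ≠ 0) :
    ∑ x, (signU χ x * signU χ (x + w) + signV χ x * signV χ (x + w)) = -2 := by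
  have hpt : ∀ x : ZMod p, signU χ x * signU χ (x + w) + signV χ x * signV χ (x + w) =
      2 * (χ x * χ⁻¹ (x + w)).re + 2 * ((χ x).im * (if x + w = 0 then 1 else 0) +
        (if x = 0 then 1 else 0) * (χ (x + w)).im) := by
    intro x
    rw [quartic_inv hβ hχ, MulChar.ringHomComp_apply, starRingEnd_apply, Zsqrtd.re_mul,
      Zsqrtd.re_star, Zsqrtd.im_star, signU, signU, signV, signV]
    linear_combination 2 * boundary_mul_eq_zero hw x
  have hinv : χ w * χ⁻¹ w = 1 := by
    rw [← MulChar.mul_apply, mul_inv_cancel, MulChar.one_apply (isUnit_iff_ne_zero.mpr hw)]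
  simp_rw [hpt]
  rw [Finset.sum_add_distrib, ← Finset.mul_sum, ← Finset.mul_sum, sum_im_boundary_eq_zero hneg,
    ← GaussianInt.re_sum, sum_mul_shift_eq_jacobiSum χ χ⁻¹ hw,
    jacobiSum_nontrivial_inv (quartic_ne_one hχ), mul_assoc (χ (-1)), hinv, hneg]
  decide

lemma sum_signU_mul_signV_add (hneg : χ (-1) = -1) {w : ZMod p} (hw : w ≠ 0) :
    ∑ x, (signU χ x * signV χ (x + w) + signV χ x * signU χ (x + w)) =
      -2 * (χ w * χ w * jacobiSum χ χ).re := by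
  have hpt : ∀ x : ZMod p, signU χ x * signV χ (x + w) + signV χ x * signU χ (x + w) =
      2 * (χ x * χ (x + w)).re - 2 * ((χ x).im * (if x + w = 0 then 1 else 0) +
        (if x = 0 then 1 else 0) * (χ (x + w)).im) := by
    intro x
    rw [Zsqrtd.re_mul, signU, signU, signV, signV]
    linear_combination -2 * boundary_mul_eq_zero hw x
  simp_rw [hpt]
  rw [Finset.sum_sub_distrib, ← Finset.mul_sum, ← Finset.mul_sum, sum_im_boundary_eq_zero hneg,
    ← GaussianInt.re_sum, sum_mul_shift_eq_jacobiSum χ χ hw, hneg, mul_assoc (-1 : GaussianInt),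
    mul_assoc (-1 : GaussianInt), neg_one_mul, Zsqrtd.re_neg]
  ring

lemma sum_signU_mul_signV (hχ : χ β = ⟨0, 1⟩) :
    ∑ x, (signU χ x * signV χ x + signV χ x * signU χ x) = -2 := by
  have hpt : ∀ x : ZMod p, signU χ x * signV χ x + signV χ x * signU χ x =
      2 * ((χ * χ) x).re - 2 * if x = 0 then 1 else 0 := by
    intro x
    rw [MulChar.mul_apply, Zsqrtd.re_mul, signU, signV]
    by_cases hx : x = 0
    · simp only [hx, MulChar.map_zero, if_true]
      decide
    · simp only [hx, if_false]
      ring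
  simp_rw [hpt]
  rw [Finset.sum_sub_distrib, ← Finset.mul_sum, ← Finset.mul_sum, ← GaussianInt.re_sum,
    MulChar.sum_eq_zero_of_ne_one (quartic_sq_ne_one hχ)]
  simp

lemma neg_one_pow_chiSeq_U {f : ℕ} (hpf : p = 4 * f + 1) (hβ : orderOf β = p - 1)
    (hχ : χ β = ⟨0, 1⟩) (t : ℤ) :
    (-1 : ℤ) ^ chiSeq p ({0} ∪ Dclass p f β 1 ∪ Dclass p f β 2) t = signU χ t := by
  simp only [chiSeq, Set.mem_union, Set.mem_singleton_iff, signU,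
    mem_Dclass_iff hpf (show 1 < 4 by norm_num) hβ hχ,
    mem_Dclass_iff hpf (show 2 < 4 by norm_num) hβ hχ]
  by_cases hx : (t : ZMod p) = 0
  · simp only [hx, MulChar.map_zero, if_true, true_or]
    decide
  · rcases quartic_values hβ hχ hx with h | h | h | h <;> simp only [h, hx, if_false, false_or] <;>
      split_ifs with h' <;> revert h' <;> decide

lemma neg_one_pow_chiSeq_V {f : ℕ} (hpf : p = 4 * f + 1) (hβ : orderOf β = p - 1)
    (hχ : χ β = ⟨0, 1⟩) (t : ℤ) :
    (-1 : ℤ) ^ chiSeq p (Dclass p f β 2 ∪ Dclass p f β 3) t = signV χ t := by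
  simp only [chiSeq, Set.mem_union, signV,
    mem_Dclass_iff hpf (show 2 < 4 by norm_num) hβ hχ,
    mem_Dclass_iff hpf (show 3 < 4 by norm_num) hβ hχ]
  by_cases hx : (t : ZMod p) = 0
  · simp only [hx, MulChar.map_zero, if_true]
    split_ifs with h' <;> revert h' <;> decide
  · rcases quartic_values hβ hχ hx with h | h | h | h <;> simp only [h, hx, if_false] <;>
      split_ifs with h' <;> revert h' <;> decide

lemma interleave_two_mul (a b : ℤ → ℕ) (i : ℤ) : interleave a b (2 * i) = a i := by
  simp [interleave]

lemma interleave_two_mul_add_one (a b : ℤ → ℕ) (i : ℤ) : interleave a b (2 * i + 1) = b i := by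
  simp [interleave]

lemma corr_interleave_even {n : ℕ} [NeZero n] {a b : ℤ → ℕ} {A B : ZMod n → ℤ}
    (ha : ∀ t : ℤ, (-1 : ℤ) ^ a t = A t) (hb : ∀ t : ℤ, (-1 : ℤ) ^ b t = B t) (h m : ℤ) :
    corr (2 * n) (interleave a (shiftL h b)) (interleave a (shiftL h b)) (2 * m) =
      ∑ x, (A x * A (x + m) + B x * B (x + m)) := by
  have hB : ∑ x, B x * B (x + m) = ∑ x, B (x + h) * B (x + h + m) :=
    (Equiv.sum_comp (Equiv.addRight (h : ZMod n)) fun x => B x * B (x + m)).symm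
  rw [Finset.sum_add_distrib, hB, ← Finset.sum_add_distrib, ← Fintype.sum_range_zmod, corr,
    Finset.sum_range_two_mul_eq]
  refine Finset.sum_congr rfl fun i _ => ?_
  have e1 : ((2 * i : ℕ) : ℤ) + 2 * m = 2 * (i + m) := by push_cast; ring
  have e2 : ((2 * i + 1 : ℕ) : ℤ) + 2 * m = 2 * (i + m) + 1 := by push_cast; ring
  rw [e1, e2]
  push_cast
  rw [interleave_two_mul, interleave_two_mul, interleave_two_mul_add_one,
    interleave_two_mul_add_one, shiftL, shiftL, pow_add, pow_add, ha, ha, hb, hb]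
  push_cast
  rw [add_right_comm (i : ZMod n)]

lemma corr_interleave_odd {n : ℕ} [NeZero n] {a b : ℤ → ℕ} {A B : ZMod n → ℤ}
    (ha : ∀ t : ℤ, (-1 : ℤ) ^ a t = A t) (hb : ∀ t : ℤ, (-1 : ℤ) ^ b t = B t) {h : ℤ}
    (hh : (2 * h : ZMod n) = 1) (m : ℤ) :
    corr (2 * n) (interleave a (shiftL h b)) (interleave a (shiftL h b)) (2 * m + 1) =
      ∑ x, (A x * B (x + (m + h)) + B x * A (x + (m + h))) := by
  have hB : ∑ x, B x * A (x + (m + h)) = ∑ x, B (x + h) * A (x + h + (m + h)) :=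
    (Equiv.sum_comp (Equiv.addRight (h : ZMod n)) fun x => B x * A (x + (m + h))).symm
  rw [Finset.sum_add_distrib, hB, ← Finset.sum_add_distrib, ← Fintype.sum_range_zmod, corr,
    Finset.sum_range_two_mul_eq]
  refine Finset.sum_congr rfl fun i _ => ?_
  have e1 : ((2 * i : ℕ) : ℤ) + (2 * m + 1) = 2 * (i + m) + 1 := by push_cast; ring
  have e2 : ((2 * i + 1 : ℕ) : ℤ) + (2 * m + 1) = 2 * (i + m + 1) := by push_cast; ring
  have e3 : (i : ZMod n) + h + (m + h) = i + m + 1 := by linear_combination hh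
  rw [e1, e2, e3]
  push_cast
  rw [interleave_two_mul, interleave_two_mul, interleave_two_mul_add_one,
    interleave_two_mul_add_one, shiftL, shiftL, pow_add, pow_add, ha, ha, hb, hb]
  push_cast
  rw [add_assoc (i : ZMod n) m h]

lemma corr_self_zero (n : ℕ) (a : ℤ → ℕ) : corr n a a 0 = n := by
  simp [corr, ← two_mul]

end InterleavedSequence

/-- autocorrelation of `s' = I(u', L^{(N+1)/2} v)`. -/
theorem stmt7 (N f y : ℕ) (hprime : N.Prime) (hNf : N = 4 * f + 1) (hN5 : 5 ≤ N)
    (hfy : f = y ^ 2) (hy : 0 < y) (hfodd : Odd f)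
    (β : ZMod N) (hβ : orderOf β = N - 1)
    (u' v s' : ℤ → ℕ)
    (hu' : u' = chiSeq N ({0} ∪ Dclass N f β 1 ∪ Dclass N f β 2))
    (hv : v = chiSeq N (Dclass N f β 2 ∪ Dclass N f β 3))
    (hs' : s' = interleave u' (shiftL (((N + 1) / 2 : ℕ) : ℤ) v)) :
    ∀ τ : ℤ, 0 ≤ τ → τ < 2 * N →
      (τ = 0 → corr (2 * N) s' s' τ = 2 * N) ∧
      (Even τ → τ ≠ 0 → corr (2 * N) s' s' τ = -2) ∧
      (τ = N → corr (2 * N) s' s' τ = -2) ∧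
      (Odd τ → τ ≠ N →
        ((((τ + N) / 2 : ℤ) : ZMod N) ∈ Dclass N f β 0 ∪ Dclass N f β 2 →
          corr (2 * N) s' s' τ = 2) ∧
        ((((τ + N) / 2 : ℤ) : ZMod N) ∈ Dclass N f β 1 ∪ Dclass N f β 3 →
          corr (2 * N) s' s' τ = -2)) := by
  intro τ hτ0 hτ
  have : Fact N.Prime := ⟨hprime⟩
  obtain ⟨χ, hχ⟩ := exists_quartic_mulChar hβ ⟨f, by omega⟩
  have hneg := quartic_neg_one hNf hfodd hβ hχ
  have hre := jacobiSum_quartic_re hNf hfodd hfy hβ hχ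
  have hu := neg_one_pow_chiSeq_U hNf hβ hχ
  have hv2 := neg_one_pow_chiSeq_V hNf hβ hχ
  rw [← hu'] at hu
  rw [← hv] at hv2
  have hN0 : ((4 * f + 1 : ℕ) : ZMod N) = 0 := by rw [← hNf, ZMod.natCast_self]
  have hh : (2 * ((((N + 1) / 2 : ℕ) : ℤ) : ZMod N) : ZMod N) = 1 := by
    have e : (N + 1) / 2 = 2 * f + 1 := by omega
    rw [e]
    push_cast at hN0 ⊢
    linear_combination hN0
  have hodd : ∀ m : ℤ, τ = 2 * m + 1 → corr (2 * N) s' s' τ =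
      ∑ x, (signU χ x * signV χ (x + (((τ + N) / 2 : ℤ) : ZMod N)) +
        signV χ x * signU χ (x + (((τ + N) / 2 : ℤ) : ZMod N))) := by
    intro m hm
    have e : (τ + N) / 2 = m + (((N + 1) / 2 : ℕ) : ℤ) := by omega
    rw [hs', e, hm, corr_interleave_odd hu hv2 hh, Int.cast_add]
  have hclass : ∀ c : ℤ, Odd τ → (((τ + N) / 2 : ℤ) : ZMod N) ≠ 0 →
      χ (((τ + N) / 2 : ℤ) : ZMod N) * χ (((τ + N) / 2 : ℤ) : ZMod N) = c →
      corr (2 * N) s' s' τ = 2 * c := by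
    rintro c ⟨m, hm⟩ hw hc
    rw [hodd m hm, sum_signU_mul_signV_add hneg hw, hc, Zsqrtd.re_mul, hre]
    simp
  have hmem : ∀ j < 4, (((τ + N) / 2 : ℤ) : ZMod N) ∈ Dclass N f β j → Odd τ →
      corr (2 * N) s' s' τ = 2 * (-1) ^ j := by
    intro j hj h hτodd
    rw [mem_Dclass_iff hNf hj hβ hχ] at h
    have hsq : (⟨0, 1⟩ : GaussianInt) * ⟨0, 1⟩ = -1 := by decide
    refine hclass _ hτodd (fun h0 => ?_) ?_
    · rw [h0, MulChar.map_zero] at h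
      interval_cases j <;> revert h <;> decide
    · rw [h, ← mul_pow, hsq]
      push_cast
      rfl
  refine ⟨?_, ?_, ?_, ?_⟩
  · rintro rfl
    rw [corr_self_zero]
    push_cast
    rfl
  · rintro ⟨m, hm⟩ h0
    rw [← two_mul] at hm
    have hm0 : (m : ZMod N) ≠ 0 := by
      intro h
      have := Int.le_of_dvd (by omega) ((ZMod.intCast_zmod_eq_zero_iff_dvd m N).mp h)
      omega
    rw [hs', hm, corr_interleave_even hu hv2, sum_signU_mul_add_signV_mul hβ hχ hneg hm0]
  · rintro hτN
    have e : (τ + N) / 2 = N := by omega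
    rw [hodd (2 * f) (by omega), e]
    simpa using sum_signU_mul_signV hχ
  · intro hτodd _
    refine ⟨?_, ?_⟩
    · rintro (h | h)
      · simpa using hmem 0 (by norm_num) h hτodd
      · simpa using hmem 2 (by norm_num) h hτodd
    · rintro (h | h)
      · simpa using hmem 1 (by norm_num) h hτodd
      · simpa [pow_succ] using hmem 3 (by norm_num) h hτodd
end

section
/- If 2 mod N ∈ D_1, then S_v(α^2) = S_{u′}(α); and if 2 mod N ∈ D_3, then S_{u′}(α^2) = S_v(α). More generally these identities hold with α replaced by any N-th root of unity different from 1 in GF(2^m). -/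
open Finset Polynomial

/-- The sequence polynomial over F_2 of a sequence of period `n`. -/
noncomputable def Spoly (n : ℕ) (s : ℤ → ℕ) : Polynomial (ZMod 2) :=
  ∑ i ∈ Finset.range n, Polynomial.C ((s (i : ℤ) : ZMod 2)) * Polynomial.X ^ i

theorem pow_mem_Dclass_iff {N f : ℕ} {β : ZMod N} (hβ : orderOf β = 4 * f) (hf : 0 < f)
    {j : ℕ} (hj : j < 4) (n : ℕ) : β ^ n ∈ Dclass N f β j ↔ n % 4 = j := by
  have hfin : IsOfFinOrder β := orderOf_pos_iff.mp (by omega)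
  constructor
  · rintro ⟨k, -, hk⟩
    have h : n ≡ 4 * k + j [MOD 4 * f] := hβ ▸ hfin.pow_eq_pow_iff_modEq.mp hk
    have h4 : n % 4 = (4 * k + j) % 4 := h.of_mul_right f
    omega
  · intro h
    have hdecomp : n % (4 * f) = 4 * (n / 4 % f) + n % 4 := by
      rw [Nat.mod_mul, add_comm]
    refine ⟨n / 4 % f, Nat.mod_lt _ hf, ?_⟩
    rw [← pow_mod_orderOf, hβ, hdecomp, h]

theorem zero_notMem_Dclass {N f : ℕ} [Fact N.Prime] {β : ZMod N} (hβ : β ≠ 0) (j : ℕ) :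
    (0 : ZMod N) ∉ Dclass N f β j := by
  rintro ⟨k, -, hk⟩
  exact pow_ne_zero _ hβ hk.symm

theorem ZMod.exists_pow_eq_of_orderOf_eq {N : ℕ} [Fact N.Prime] {β : ZMod N}
    (hβ : orderOf β = N - 1) {x : ZMod N} (hx : x ≠ 0) : ∃ n : ℕ, β ^ n = x := by
  have hN := (Fact.out : N.Prime).two_le
  have hprim : IsPrimitiveRoot β (N - 1) := hβ ▸ IsPrimitiveRoot.orderOf β
  have : NeZero (N - 1) := ⟨by omega⟩
  obtain ⟨n, -, hn⟩ := hprim.eq_pow_of_pow_eq_one (ZMod.pow_card_sub_one_eq_one hx)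
  exact ⟨n, hn⟩

theorem ZMod.sum_range_eq_sum_univ {N : ℕ} [NeZero N] {M : Type*} [AddCommMonoid M]
    (g : ℕ → M) : ∑ i ∈ Finset.range N, g i = ∑ x : ZMod N, g x.val := by
  refine Finset.sum_bij' (fun i _ => (i : ZMod N)) (fun x _ => x.val) ?_ ?_ ?_ ?_ ?_
  · simp
  · intro x _
    exact Finset.mem_range.mpr x.val_lt
  · intro i hi
    exact ZMod.val_cast_of_lt (Finset.mem_range.mp hi)
  · simp
  · intro i hi
    rw [ZMod.val_cast_of_lt (Finset.mem_range.mp hi)]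

open Classical in
theorem aeval_Spoly_chiSeq {N : ℕ} [NeZero N] {F : Type*} [Field F] [Algebra (ZMod 2) F]
    (S : Set (ZMod N)) (z : F) :
    aeval z (Spoly N (chiSeq N S)) = ∑ x : ZMod N, if x ∈ S then z ^ x.val else 0 := by
  rw [Spoly, map_sum, ZMod.sum_range_eq_sum_univ]
  refine Finset.sum_congr rfl fun x _ => ?_
  by_cases hx : x ∈ S <;> simp [chiSeq, hx]

/-- If multiplication by two carries the complement of `S` onto `T`, then
`S(z ^ 2) = T(z)` at every nontrivial `N`-th root of unity `z`. -/
theorem aeval_sq_Spoly_chiSeq {N : ℕ} [Fact N.Prime] (h2 : (2 : ZMod N) ≠ 0)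
    {F : Type*} [Field F] [Algebra (ZMod 2) F] {S T : Set (ZMod N)}
    (hST : ∀ x, 2 * x ∈ T ↔ x ∉ S) {z : F} (hz : z ^ N = 1) (hz1 : z ≠ 1) :
    aeval (z ^ 2) (Spoly N (chiSeq N S)) = aeval z (Spoly N (chiSeq N T)) := by
  classical
  have : CharP F 2 := charP_of_injective_algebraMap (algebraMap (ZMod 2) F).injective 2
  have hval (x : ZMod N) : z ^ (2 * x).val = (z ^ 2) ^ x.val := by
    rw [← pow_mul, pow_eq_pow_mod (2 * x.val) hz, ← ZMod.val_natCast]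
    simp
  have hdouble (g : ZMod N → F) : ∑ x, g (2 * x) = ∑ y, g y :=
    Equiv.sum_comp (Equiv.mulLeft₀ (2 : ZMod N) h2) g
  have hT : ∑ y : ZMod N, (if y ∈ T then z ^ y.val else 0)
      = ∑ x : ZMod N, if x ∈ S then 0 else (z ^ 2) ^ x.val := by
    rw [← hdouble]
    refine Finset.sum_congr rfl fun x _ => ?_
    by_cases hx : x ∈ S <;> simp [hST, hx, hval]
  have hzero : ∑ x : ZMod N, (z ^ 2) ^ x.val = 0 := by
    simp_rw [← hval]
    rw [hdouble (fun y => z ^ y.val),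
      ← ZMod.sum_range_eq_sum_univ (fun i => z ^ i), geom_sum_eq hz1, hz, sub_self, zero_div]
  rw [aeval_Spoly_chiSeq, aeval_Spoly_chiSeq, hT, ← sub_eq_zero, CharTwo.sub_eq_add,
    ← Finset.sum_add_distrib]
  refine Eq.trans (Finset.sum_congr rfl fun x _ => ?_) hzero
  split_ifs <;> simp

/-- `2 ∈ D_1 ⇒ S_v(ζ²) = S_{u'}(ζ)` and `2 ∈ D_3 ⇒ S_{u'}(ζ²) = S_v(ζ)`
for every `N`-th root of unity `ζ ≠ 1`. -/
theorem stmt15 (N f : ℕ) (hprime : N.Prime) (hNf : N = 4 * f + 1) (hN5 : 5 ≤ N)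
    (β : ZMod N) (hβ : orderOf β = N - 1)
    (F : Type*) [Field F] [Algebra (ZMod 2) F]
    (α : F) (hα : IsPrimitiveRoot α N)
    (u' v : ℤ → ℕ)
    (hu' : u' = chiSeq N ({0} ∪ Dclass N f β 0 ∪ Dclass N f β 1))
    (hv : v = chiSeq N (Dclass N f β 1 ∪ Dclass N f β 2)) :
    (((2 : ZMod N) ∈ Dclass N f β 1 → ∀ ζ : F, ζ ^ N = 1 → ζ ≠ 1 →
        Polynomial.aeval (ζ ^ 2) (Spoly N v) = Polynomial.aeval ζ (Spoly N u'))) ∧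
    (((2 : ZMod N) ∈ Dclass N f β 3 → ∀ ζ : F, ζ ^ N = 1 → ζ ≠ 1 →
        Polynomial.aeval (ζ ^ 2) (Spoly N u') = Polynomial.aeval ζ (Spoly N v))) := by
  have : Fact N.Prime := ⟨hprime⟩
  have hord : orderOf β = 4 * f := by omega
  have hf : 0 < f := by omega
  have hβ0 : β ≠ 0 := by
    rintro rfl
    rw [orderOf_zero] at hβ
    omega
  have hmem {j : ℕ} (hj : j < 4) (n : ℕ) := pow_mem_Dclass_iff hord hf hj n
  subst hu' hv
  constructor
  all_goals
    rintro ⟨k, -, hk⟩ ζ hζ hζ1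
    refine aeval_sq_Spoly_chiSeq (hk ▸ pow_ne_zero _ hβ0) (fun x => ?_) hζ hζ1
    rcases eq_or_ne x 0 with rfl | hx
    · simp [zero_notMem_Dclass hβ0]
    obtain ⟨n, rfl⟩ := ZMod.exists_pow_eq_of_orderOf_eq hβ hx
    rw [hk, ← pow_add]
    simp only [Set.mem_union, Set.mem_singleton_iff, pow_ne_zero _ hβ0, false_or,
      hmem (show 0 < 4 by decide), hmem (show 1 < 4 by decide), hmem (show 2 < 4 by decide)]
    omega
end
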